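/- (Weighted Sobolev estimate in polar coordinates) Let n ≥ 2, R ≥ 3, b ∈ ℝ, and 2 ≤ p ≤ q ≤ ∞. Then ‖ r^b u ‖_{L^q_r L^∞_ω (r ≥ R+1)} ≲ ‖ r^{b − (n-1)/p + (n-1)/q} Y^{≤ ⌊(n+2)/2⌋} u ‖_{L^p_r L^2_ω (r ≥ R)}, where Y ranges over the spatial derivatives ∂_1,…,∂_n and the rotational vector fields Ω_{ij} = x^i ∂_j − x^j ∂_i, and Y^{≤ k} u denotes the collection of all products of at most k such vector fields applied to u. -/

import Mathlib

open MeasureTheory Metric Set ENNReal NNReal FourierTransform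

noncomputable section

/-- Euclidean space ℝⁿ. -/
abbrev Euc (n : ℕ) := EuclideanSpace ℝ (Fin n)

/-- Surface measure on the unit sphere of ℝⁿ. -/
def sphMeas (n : ℕ) : Measure (sphere (0 : Euc n) 1) :=
  (volume : Measure (Euc n)).toSphere

/-- `L²` norm (valued in ℝ≥0∞) of a function on the unit sphere of ℝⁿ. -/
def L2sph {n : ℕ} (g : sphere (0 : Euc n) 1 → ℂ) : ℝ≥0∞ :=
  (∫⁻ ω, (‖g ω‖₊ : ℝ≥0∞) ^ (2 : ℝ) ∂(sphMeas n)) ^ (1/2 : ℝ)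

/-- Sobolev–Slobodeckij norm `H^σ` (valued in ℝ≥0∞) on the unit sphere of ℝⁿ,
defined via the Gagliardo seminorm; for `σ = 0` it is the `L²` norm. -/
def HsphNorm {n : ℕ} (σ : ℝ) (g : sphere (0 : Euc n) 1 → ℂ) : ℝ≥0∞ :=
  L2sph g + (if σ = 0 then 0 else
    (∫⁻ ω, ∫⁻ ω', (‖g ω - g ω'‖₊ : ℝ≥0∞) ^ (2:ℝ) /
        ENNReal.ofReal (dist ω ω' ^ ((n : ℝ) - 1 + 2 * σ)) ∂(sphMeas n) ∂(sphMeas n))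
      ^ (1/2 : ℝ))

/-- Homogeneous Sobolev norm `Ḣ^s` (valued in ℝ≥0∞), defined on the Fourier side. -/
def homSobNorm {n : ℕ} (s : ℝ) (f : Euc n → ℂ) : ℝ≥0∞ :=
  (∫⁻ ξ : Euc n, ENNReal.ofReal (‖ξ‖ ^ (2 * s)) * (‖𝓕 f ξ‖₊ : ℝ≥0∞) ^ (2:ℝ)) ^ (1/2 : ℝ)

/-- Weighted `L²` norm `‖ |x|^β g ‖_{L²}` (valued in ℝ≥0∞). -/
def wL2 {n : ℕ} (β : ℝ) (g : Euc n → ℝ≥0∞) : ℝ≥0∞ :=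
  (∫⁻ x : Euc n, (ENNReal.ofReal (‖x‖ ^ β) * g x) ^ (2:ℝ)) ^ (1/2 : ℝ)

/-- Index type for the vector fields `Y = (∂_1, …, ∂_n, Ω_{ij})`. -/
abbrev YIdx (n : ℕ) := Fin n ⊕ (Fin n × Fin n)

/-- The vector field with index `i`: a spatial derivative `∂_i`, or a rotation
`Ω_{ij} = x^i ∂_j - x^j ∂_i`, applied to a function. -/
def Yop {n : ℕ} (i : YIdx n) (u : Euc n → ℂ) : Euc n → ℂ :=
  match i with
  | Sum.inl i => fun x => fderiv ℝ u x (EuclideanSpace.single i (1:ℝ))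
  | Sum.inr (i, j) => fun x =>
      (x i : ℂ) * fderiv ℝ u x (EuclideanSpace.single j (1:ℝ)) -
        (x j : ℂ) * fderiv ℝ u x (EuclideanSpace.single i (1:ℝ))

/-- Composition of the vector fields indexed by `ops`, applied to `u`. -/
def Yapply {n : ℕ} {m : ℕ} (ops : Fin m → YIdx n) (u : Euc n → ℂ) : Euc n → ℂ :=
  (List.ofFn ops).foldr Yop u

/-- `L^q_r` norm (in ℝ≥0∞, w.r.t. `r^{n-1} dr`) on `(a, ∞)`, with `q = ∞` being
the sup norm. -/
def LqrNorm (n : ℕ) (q : ℝ≥0∞) (a : ℝ) (F : ℝ → ℝ≥0∞) : ℝ≥0∞ :=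
  if q = ∞ then ⨆ r : ℝ, ⨆ _ : a < r, F r
  else (∫⁻ r in Ioi a, (F r) ^ q.toReal * ENNReal.ofReal (r ^ ((n:ℝ) - 1))) ^ (1/q.toReal)

lemma jap_le (n k : ℕ) (ξ : Euc n) :
    (1 + ‖ξ‖) ^ k ≤ ((n:ℝ) + 1) ^ k * (1 + ∑ j, |ξ j| ^ k) := by
  have h1 : ‖ξ‖ ≤ ∑ j, |ξ j| := by
    conv_lhs => rw [← (EuclideanSpace.basisFun (Fin n) ℝ).sum_repr ξ]
    refine (norm_sum_le _ _).trans (le_of_eq ?_)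
    refine Finset.sum_congr rfl fun j _ => ?_
    simp [norm_smul]
  by_cases h : ∀ j, |ξ j| ≤ 1
  · have h2 : 1 + ‖ξ‖ ≤ (n:ℝ) + 1 := by
      have : ∑ j, |ξ j| ≤ ∑ j : Fin n, (1:ℝ) := Finset.sum_le_sum fun j _ => h j
      simp at this
      linarith
    have h3 : 0 ≤ ∑ j, |ξ j| ^ k := Finset.sum_nonneg fun j _ => by positivity
    calc (1 + ‖ξ‖) ^ k ≤ ((n:ℝ) + 1) ^ k := pow_le_pow_left₀ (by positivity) h2 k
      _ ≤ _ := le_mul_of_one_le_right (by positivity) (by linarith)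
  · push Not at h
    obtain ⟨j1, hj1⟩ := h
    obtain ⟨j0, -, hj0⟩ := Finset.exists_max_image Finset.univ (fun j => |ξ j|) ⟨j1, Finset.mem_univ _⟩
    have h2 : 1 + ‖ξ‖ ≤ ((n:ℝ) + 1) * |ξ j0| := by
      have : ∑ j, |ξ j| ≤ ∑ j : Fin n, |ξ j0| := Finset.sum_le_sum fun j _ => hj0 j (Finset.mem_univ _)
      simp at this
      have := hj0 j1 (Finset.mem_univ _)
      linarith
    have h3 : |ξ j0| ^ k ≤ ∑ j, |ξ j| ^ k :=
      Finset.single_le_sum (f := fun j => |ξ j| ^ k) (fun j _ => by positivity) (Finset.mem_univ j0)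
    calc (1 + ‖ξ‖) ^ k ≤ (((n:ℝ) + 1) * |ξ j0|) ^ k := pow_le_pow_left₀ (by positivity) h2 k
      _ = ((n:ℝ) + 1) ^ k * |ξ j0| ^ k := mul_pow _ _ _
      _ ≤ _ := by gcongr; linarith

open SchwartzMap LineDeriv in
/-- `k`-th derivative in direction `e_j` on Schwartz functions. -/
def Dk {n : ℕ} (j : Fin n) (k : ℕ) (f : SchwartzMap (Euc n) ℂ) : SchwartzMap (Euc n) ℂ :=
  (fun g : SchwartzMap (Euc n) ℂ => ∂_{(EuclideanSpace.single j (1:ℝ) : Euc n)} g)^[k] f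

open SchwartzMap LineDeriv in
lemma fourier_Dk {n : ℕ} (j : Fin n) (k : ℕ) (f : SchwartzMap (Euc n) ℂ) (ξ : Euc n) :
    ‖(𝓕 (Dk j k f)) ξ‖ = (2 * Real.pi * |ξ j|) ^ k * ‖(𝓕 f) ξ‖ := by
  induction k generalizing f with
  | zero => simp [Dk]
  | succ k ih =>
    have : Dk j (k+1) f = Dk j k (∂_{(EuclideanSpace.single j (1:ℝ) : Euc n)} f) := by
      simp [Dk]
    rw [this, ih, SchwartzMap.fourier_lineDerivOp_eq]
    rw [_root_.smul_apply, SchwartzMap.smulLeftCLM_apply_apply (by fun_prop)]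
    rw [norm_smul, norm_smul]
    have h1 : inner ℝ ξ (EuclideanSpace.single j (1:ℝ)) = ξ j := by
      rw [EuclideanSpace.inner_single_right]; simp
    have hp := Real.pi_pos
    rw [h1]
    simp [abs_of_pos hp]
    ring

lemma plancherel_eLp {n : ℕ} (f : SchwartzMap (Euc n) ℂ) :
    eLpNorm (𝓕 f : SchwartzMap (Euc n) ℂ) 2 volume = eLpNorm f 2 volume := by
  have h := SchwartzMap.norm_fourier_toL2_eq f
  rw [SchwartzMap.norm_toLp, SchwartzMap.norm_toLp] at h
  exact (ENNReal.toReal_eq_toReal_iff' ((𝓕 f).memLp 2 volume).2.ne (f.memLp 2 volume).2.ne).1 h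

lemma weighted_L1 (n k : ℕ) (hk : n < 2 * k) :
    ∃ C : ℝ≥0, ∀ (g : Euc n → ℂ) (G : Fin n → Euc n → ℂ), Continuous g → (∀ j, Continuous (G j)) →
      (∀ j ξ, |ξ j| ^ k * ‖g ξ‖ ≤ ‖G j ξ‖) →
      ∫⁻ ξ, ‖g ξ‖ₑ ≤ C * (eLpNorm g 2 volume + ∑ j, eLpNorm (G j) 2 volume) := by
  have hI : Integrable (fun x : Euc n => (1 + ‖x‖) ^ (-((2*k:ℕ):ℝ))) volume :=
    integrable_one_add_norm (by simp only [finrank_euclideanSpace, Fintype.card_fin]; exact_mod_cast hk)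
  have hJ : ∫⁻ x : Euc n, (ENNReal.ofReal ((1 + ‖x‖) ^ k)⁻¹) ^ (2:ℝ) < ∞ := by
    have := hI.lintegral_lt_top
    convert this using 3 with x
    rw [Real.rpow_neg (by positivity), Real.rpow_natCast, ENNReal.ofReal_rpow_of_nonneg (by positivity) (by norm_num)]
    congr 1
    rw [show (2:ℝ) = ((2:ℕ):ℝ) by norm_num, Real.rpow_natCast, inv_pow, ← pow_mul, mul_comm]
  set J := (∫⁻ x : Euc n, (ENNReal.ofReal ((1 + ‖x‖) ^ k)⁻¹) ^ (2:ℝ)) ^ (1/(2:ℝ)) with hJdef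
  have hJ' : J ≠ ∞ := (ENNReal.rpow_lt_top_of_nonneg (by norm_num) hJ.ne).ne
  refine ⟨J.toNNReal * (((n:ℝ≥0) + 1) ^ k), fun g G hg hG hgG => ?_⟩
  have h2 : ∫⁻ ξ, ‖g ξ‖ₑ ≤ J * (∫⁻ ξ, (ENNReal.ofReal ((1 + ‖ξ‖) ^ k) * ‖g ξ‖ₑ) ^ (2:ℝ)) ^ (1/(2:ℝ)) := by
    refine le_trans (le_of_eq ?_) (ENNReal.lintegral_mul_le_Lp_mul_Lq volume Real.HolderConjugate.two_two
      (f := fun ξ : Euc n => ENNReal.ofReal ((1 + ‖ξ‖) ^ k)⁻¹) (g := fun ξ => ENNReal.ofReal ((1 + ‖ξ‖) ^ k) * ‖g ξ‖ₑ)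
      (by fun_prop) ?_)
    · refine lintegral_congr fun ξ => ?_
      simp only [Pi.mul_apply]
      rw [← mul_assoc, ← ENNReal.ofReal_mul (by positivity), inv_mul_cancel₀ (by positivity)]
      simp
    · have : Measurable fun ξ => ‖g ξ‖ₑ := hg.enorm.measurable
      exact (Measurable.mul (by fun_prop) this).aemeasurable
  have h3 : (∫⁻ ξ, (ENNReal.ofReal ((1 + ‖ξ‖) ^ k) * ‖g ξ‖ₑ) ^ (2:ℝ)) ^ (1/(2:ℝ)) =
      eLpNorm (fun ξ => (1 + ‖ξ‖) ^ k * ‖g ξ‖) 2 volume := by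
    rw [eLpNorm_eq_lintegral_rpow_enorm_toReal (by norm_num) (by norm_num)]
    simp only [ENNReal.toReal_ofNat]
    congr 2; ext ξ
    rw [Real.enorm_of_nonneg (by positivity), ENNReal.ofReal_mul (by positivity), ofReal_norm]
  have h4 : eLpNorm (fun ξ => (1 + ‖ξ‖) ^ k * ‖g ξ‖) 2 volume ≤
      ENNReal.ofReal (((n:ℝ) + 1) ^ k) * eLpNorm (fun ξ => ‖g ξ‖ + ∑ j, ‖G j ξ‖) 2 volume := by
    refine (eLpNorm_le_mul_eLpNorm_of_ae_le_mul (c := ((n:ℝ) + 1) ^ k)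
      (g := fun ξ => ‖g ξ‖ + ∑ j, ‖G j ξ‖) (Filter.Eventually.of_forall fun ξ => ?_) 2)
    have hn1 : 0 ≤ ∑ j, ‖G j ξ‖ := Finset.sum_nonneg fun j _ => norm_nonneg _
    rw [Real.norm_of_nonneg (by positivity), Real.norm_of_nonneg (by positivity)]
    calc (1 + ‖ξ‖) ^ k * ‖g ξ‖ ≤ ((n:ℝ) + 1) ^ k * (1 + ∑ j, |ξ j| ^ k) * ‖g ξ‖ := by
          gcongr; exact jap_le n k ξ
      _ = ((n:ℝ) + 1) ^ k * (‖g ξ‖ + ∑ j, |ξ j| ^ k * ‖g ξ‖) := by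
          rw [mul_assoc, add_mul, one_mul, Finset.sum_mul]
      _ ≤ _ := by
          gcongr with j
          exact hgG j ξ
  have h5 : eLpNorm (fun ξ => ‖g ξ‖ + ∑ j, ‖G j ξ‖) 2 volume ≤
      eLpNorm g 2 volume + ∑ j, eLpNorm (G j) 2 volume := by
    refine (eLpNorm_add_le (f := fun ξ => ‖g ξ‖) (g := fun ξ => ∑ j, ‖G j ξ‖) hg.norm.aestronglyMeasurable
      (Continuous.aestronglyMeasurable (continuous_finsetSum _ fun j _ => (hG j).norm)) (by norm_num)).trans ?_
    rw [eLpNorm_norm]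
    gcongr
    have := eLpNorm_sum_le (f := fun j ξ => ‖G j ξ‖) (s := Finset.univ) (μ := volume) (p := 2)
      (fun j _ => (hG j).norm.aestronglyMeasurable) (by norm_num)
    simp only [eLpNorm_norm] at this
    refine le_trans (le_of_eq ?_) this
    congr 1; ext ξ; simp
  calc ∫⁻ ξ, ‖g ξ‖ₑ ≤ J * (ENNReal.ofReal (((n:ℝ) + 1) ^ k) * (eLpNorm g 2 volume + ∑ j, eLpNorm (G j) 2 volume)) := by
        refine h2.trans ?_
        rw [h3]
        gcongr
        refine h4.trans ?_
        gcongr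
    _ = _ := by
      rw [← mul_assoc]
      congr 1
      push_cast
      rw [ENNReal.coe_toNNReal hJ', ENNReal.ofReal_pow (by positivity), ENNReal.ofReal_add (by positivity) (by positivity)]
      simp

lemma sobolev_schwartz (n k : ℕ) (hk : n < 2 * k) :
    ∃ C : ℝ≥0, ∀ (f : SchwartzMap (Euc n) ℂ) (x : Euc n),
      ‖f x‖ₑ ≤ C * (eLpNorm f 2 volume + ∑ j, eLpNorm (Dk j k f) 2 volume) := by
  obtain ⟨C, hC⟩ := weighted_L1 n k hk
  refine ⟨C, fun f x => ?_⟩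
  have h1 : ‖f x‖ₑ ≤ ∫⁻ ξ, ‖(𝓕 f : SchwartzMap (Euc n) ℂ) ξ‖ₑ := by
    have h0 : f = 𝓕⁻ (𝓕 f : SchwartzMap (Euc n) ℂ) := by simp
    have : f x = ∫ ξ, Real.fourierChar (inner ℝ ξ x) • (𝓕 f : SchwartzMap (Euc n) ℂ) ξ := by
      conv_lhs => rw [h0]
      rw [SchwartzMap.fourierInv_coe, Real.fourierInv_eq]
    rw [this]
    refine (enorm_integral_le_lintegral_enorm _).trans (le_of_eq ?_)
    refine lintegral_congr fun ξ => ?_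
    rw [← ofReal_norm, ← ofReal_norm, Circle.norm_smul]
  refine h1.trans ?_
  have := hC (𝓕 f : SchwartzMap (Euc n) ℂ) (fun j => (𝓕 (Dk j k f) : SchwartzMap (Euc n) ℂ)) (SchwartzMap.continuous _)
    (fun j => SchwartzMap.continuous _) (fun j ξ => by
      rw [fourier_Dk]
      gcongr
      have : 1 ≤ 2 * Real.pi := by have := Real.pi_gt_three; linarith
      nlinarith [abs_nonneg (ξ j)])
  simpa only [plancherel_eLp] using this

/-- The radial shift `x ↦ (|x| + ρ) x/|x|`. -/
def Phi {n : ℕ} (ρ : ℝ) (x : Euc n) : Euc n := (1 + ρ * ‖x‖⁻¹) • x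

/-- The annulus `3/2 ≤ |x| ≤ 5/2`. -/
def Ann (n : ℕ) : Set (Euc n) := {x | 3/2 ≤ ‖x‖ ∧ ‖x‖ ≤ 5/2}

/-- Smooth coefficients supported in the annulus. -/
structure GoodC {n : ℕ} (c : Euc n → ℝ) : Prop where
  smooth : ContDiff ℝ (⊤ : ℕ∞) c
  supp : ∀ x, x ∉ Ann n → c x = 0

/-- Sum of all `|Y^{≤ k} v|`, defined recursively. -/
def NN {n : ℕ} : ℕ → (Euc n → ℂ) → Euc n → ℝ
  | 0, v, y => ‖v y‖
  | (k+1), v, y => ‖v y‖ + ∑ i : YIdx n, NN k (Yop i v) y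

lemma isClosed_Ann (n : ℕ) : IsClosed (Ann n) :=
  (isClosed_le continuous_const continuous_norm).inter (isClosed_le continuous_norm continuous_const)

lemma zero_notMem_Ann (n : ℕ) : (0 : Euc n) ∉ Ann n := by
  simp [Ann]

lemma GoodC.eventually {n : ℕ} {c : Euc n → ℝ} (hc : GoodC c) {x : Euc n} (hx : x ∉ Ann n) :
    ∀ᶠ y in nhds x, c y = 0 := by
  filter_upwards [(isClosed_Ann n).isOpen_compl.mem_nhds hx] with y hy using hc.supp y hy

lemma GoodC.smooth_smul {n : ℕ} {F : Type*} [NormedAddCommGroup F] [NormedSpace ℝ F] {c : Euc n → ℝ} (hc : GoodC c) {h : Euc n → F}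
    (hh : ∀ x, x ≠ 0 → ContDiffAt ℝ (⊤ : ℕ∞) h x) : ContDiff ℝ (⊤ : ℕ∞) (fun x => c x • h x) := by
  rw [contDiff_iff_contDiffAt]
  intro x
  by_cases hx : x = 0
  · have : (fun x => c x • h x) =ᶠ[nhds x] fun _ => 0 := by
      filter_upwards [hc.eventually (x := x) (hx ▸ zero_notMem_Ann n)] with y hy
      simp [hy]
    exact contDiffAt_const.congr_of_eventuallyEq this
  · exact hc.smooth.contDiffAt.smul (hh x hx)

lemma GoodC.mul {n : ℕ} {c : Euc n → ℝ} (hc : GoodC c) {h : Euc n → ℝ}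
    (hh : ∀ x, x ≠ 0 → ContDiffAt ℝ (⊤ : ℕ∞) h x) : GoodC (fun x => c x * h x) :=
  ⟨hc.smooth_smul hh, fun x hx => by simp [hc.supp x hx]⟩

lemma GoodC.deriv {n : ℕ} {c : Euc n → ℝ} (hc : GoodC c) (w : Euc n) :
    GoodC (fun x => fderiv ℝ c x w) := by
  refine ⟨(hc.smooth.fderiv_right (m := (⊤ : ℕ∞)) (by simp)).clm_apply contDiff_const, fun x hx => ?_⟩
  have : c =ᶠ[nhds x] fun _ => 0 := hc.eventually hx
  simp [this.fderiv_eq]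

lemma GoodC.bound {n : ℕ} {c : Euc n → ℝ} (hc : GoodC c) :
    ∃ C : ℝ, 0 ≤ C ∧ ∀ x, |c x| ≤ C * (Ann n).indicator (fun _ => (1:ℝ)) x := by
  have hK : IsCompact (Ann n) := by
    refine (isCompact_closedBall (0 : Euc n) (5/2)).of_isClosed_subset (isClosed_Ann n) fun x hx => ?_
    simpa using hx.2
  obtain ⟨C, hC⟩ := hK.exists_bound_of_continuousOn hc.smooth.continuous.continuousOn
  refine ⟨max C 0, le_max_right _ _, fun x => ?_⟩
  by_cases hx : x ∈ Ann n
  · simp only [hx, indicator_of_mem, mul_one]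
    exact (hC x hx).trans (le_max_left _ _)
  · simp [hx, hc.supp x hx]

lemma Yop_smooth {n : ℕ} {v : Euc n → ℂ} (hv : ContDiff ℝ (⊤ : ℕ∞) v) (i : YIdx n) :
    ContDiff ℝ (⊤ : ℕ∞) (Yop i v) := by
  have h (w : Euc n) : ContDiff ℝ (⊤ : ℕ∞) (fun x => fderiv ℝ v x w) :=
    (hv.fderiv_right (m := (⊤ : ℕ∞)) (by simp)).clm_apply contDiff_const
  have h2 (j : Fin n) : ContDiff ℝ (⊤ : ℕ∞) (fun x : Euc n => ((x j : ℝ) : ℂ)) := by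
    refine Complex.ofRealCLM.contDiff.comp ?_
    exact (EuclideanSpace.proj (𝕜 := ℝ) j).contDiff
  rcases i with i | ⟨i, j⟩
  · exact h _
  · exact ((h2 i).mul (h _)).sub ((h2 j).mul (h _))

lemma NN_nonneg {n : ℕ} (k : ℕ) (v : Euc n → ℂ) (y : Euc n) : 0 ≤ NN k v y := by
  induction k generalizing v with
  | zero => simp [NN]
  | succ k ih => simp only [NN]; exact add_nonneg (norm_nonneg _) (Finset.sum_nonneg fun i _ => ih _)

lemma NN_mono {n : ℕ} (k : ℕ) (v : Euc n → ℂ) (y : Euc n) : NN k v y ≤ NN (k+1) v y := by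
  induction k generalizing v with
  | zero => simp only [NN]; exact le_add_of_nonneg_right (Finset.sum_nonneg fun i _ => norm_nonneg _)
  | succ k ih => 
    rw [NN, NN]
    gcongr
    exact ih _

lemma NN_Yop {n : ℕ} (k : ℕ) (i : YIdx n) (v : Euc n → ℂ) (y : Euc n) : NN k (Yop i v) y ≤ NN (k+1) v y := by
  rw [NN]
  have := Finset.single_le_sum (f := fun i => NN k (Yop i v) y) (fun i _ => NN_nonneg _ _ _) (Finset.mem_univ i)
  have := norm_nonneg (v y)
  linarith

lemma contDiffAt_inv_norm {n : ℕ} {x : Euc n} (hx : x ≠ 0) :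
    ContDiffAt ℝ (⊤ : ℕ∞) (fun x : Euc n => ‖x‖⁻¹) x :=
  (contDiffAt_norm ℝ hx).inv (norm_ne_zero_iff.2 hx)

lemma contDiffAt_Phi {n : ℕ} (ρ : ℝ) {x : Euc n} (hx : x ≠ 0) :
    ContDiffAt ℝ (⊤ : ℕ∞) (Phi ρ : Euc n → Euc n) x :=
  (contDiffAt_const.add (contDiffAt_const.mul (contDiffAt_inv_norm hx))).smul contDiffAt_id

lemma exists_schwartz {n : ℕ} {c : Euc n → ℝ} (hc : GoodC c) (ρ : ℝ) {v : Euc n → ℂ}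
    (hv : ContDiff ℝ (⊤ : ℕ∞) v) :
    ∃ f : SchwartzMap (Euc n) ℂ, ∀ x, f x = c x • v (Phi ρ x) := by
  have h1 : ContDiff ℝ (⊤ : ℕ∞) (fun x => c x • v (Phi ρ x)) :=
    hc.smooth_smul fun x hx => hv.contDiffAt.comp x (contDiffAt_Phi ρ hx)
  have h2 : HasCompactSupport (fun x => c x • v (Phi ρ x)) := by
    refine HasCompactSupport.intro (isCompact_closedBall (0 : Euc n) (5/2)) fun x hx => ?_
    have : x ∉ Ann n := fun h => hx (by simpa using h.2)
    simp [hc.supp x this]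
  exact ⟨h2.toSchwartzMap h1, fun x => rfl⟩

lemma hasFDerivAt_norm' {n : ℕ} {x : Euc n} (hx : x ≠ 0) :
    ∃ L : Euc n →L[ℝ] ℝ, HasFDerivAt (fun x : Euc n => ‖x‖) L x ∧ ∀ j, L (EuclideanSpace.single j 1) = x j / ‖x‖ := by
  have hd : DifferentiableAt ℝ (fun x : Euc n => ‖x‖) x :=
    (contDiffAt_norm (n := 1) ℝ hx).differentiableAt (by simp)
  refine ⟨_, hd.hasFDerivAt, fun j => ?_⟩
  have h1 := hd.hasFDerivAt.mul hd.hasFDerivAt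
  have h2 := (hasStrictFDerivAt_norm_sq x).hasFDerivAt
  simp only [pow_two] at h2
  have h3 := congrArg (fun L : Euc n →L[ℝ] ℝ => L (EuclideanSpace.single j 1)) (h1.unique h2)
  simp [EuclideanSpace.inner_single_right] at h3
  have : ‖x‖ ≠ 0 := norm_ne_zero_iff.2 hx
  field_simp
  linarith

lemma fderiv_term {n : ℕ} {c : Euc n → ℝ} (hc : GoodC c) (ρ : ℝ) {v : Euc n → ℂ}
    (hv : ContDiff ℝ (⊤ : ℕ∞) v) (j : Fin n) (x : Euc n) :
    fderiv ℝ (fun x => c x • v (Phi ρ x)) x (EuclideanSpace.single j 1) =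
      fderiv ℝ c x (EuclideanSpace.single j 1) • v (Phi ρ x) +
      ∑ i, (c x * (x j * x i * (‖x‖⁻¹) ^ 2)) • Yop (Sum.inl i) v (Phi ρ x) +
      ∑ i, (c x * (x i * (‖x‖⁻¹) ^ 2)) • Yop (Sum.inr (i, j)) v (Phi ρ x) := by
  by_cases hx : x = 0
  · have h0 : x ∉ Ann n := hx ▸ zero_notMem_Ann n
    have : (fun x => c x • v (Phi ρ x)) =ᶠ[nhds x] fun _ => 0 := by
      filter_upwards [hc.eventually (x := x) h0] with y hy
      simp [hy]
    rw [this.fderiv_eq]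
    simp [hc.supp x h0, (hc.deriv (EuclideanSpace.single j 1)).supp x h0]
  have hnx : ‖x‖ ≠ 0 := norm_ne_zero_iff.2 hx
  obtain ⟨N, hN, hNj⟩ := hasFDerivAt_norm' hx
  have hinv : HasFDerivAt (fun x : Euc n => ‖x‖⁻¹) ((-(‖x‖ ^ 2)⁻¹) • N) x :=
    (hasDerivAt_inv hnx).comp_hasFDerivAt x hN
  have hP : HasFDerivAt (Phi ρ : Euc n → Euc n) ((1 + ρ * ‖x‖⁻¹) • ContinuousLinearMap.id ℝ (Euc n) + (ρ • (-(‖x‖ ^ 2)⁻¹) • N).smulRight x) x :=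
    ((hinv.const_mul ρ).const_add 1).smul (hasFDerivAt_id x)
  have hv' := (hv.differentiable (by simp) (Phi ρ x)).hasFDerivAt
  have hc' := (hc.smooth.differentiable (by simp) x).hasFDerivAt
  have H := hc'.smul (hv'.comp x hP)
  rw [HasFDerivAt.fderiv (f := fun x => c x • v (Phi ρ x)) H]
  set L := fderiv ℝ v (Phi ρ x) with hL
  set e : Fin n → ℂ := fun i => L (EuclideanSpace.single i 1) with he
  have hLx : L x = ∑ i, (x i : ℂ) * e i := by
    have : x = ∑ i, x i • EuclideanSpace.single i (1:ℝ) := by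
      conv_lhs => rw [← (EuclideanSpace.basisFun (Fin n) ℝ).sum_repr x]
      simp
    conv_lhs => rw [this]
    simp [he]
  have hsq : ∑ i, (x i : ℂ) ^ 2 = (‖x‖ : ℂ) ^ 2 := by
    have := EuclideanSpace.real_norm_sq_eq x
    rw [← Complex.ofReal_pow, this]
    push_cast; rfl
  have hnx' : (‖x‖ : ℂ) ≠ 0 := by exact_mod_cast hnx
  have s1 : ∑ i, (c x * (x j * x i * (‖x‖⁻¹) ^ 2)) • Yop (Sum.inl i) v (Phi ρ x) =
      (c x : ℂ) * x j * (‖x‖ : ℂ)⁻¹ ^ 2 * L x := by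
    rw [hLx, Finset.mul_sum]
    refine Finset.sum_congr rfl fun i _ => ?_
    simp only [Yop, ← hL, Complex.real_smul]
    simp only [he]
    push_cast
    ring
  have s2 : ∑ i, (c x * (x i * (‖x‖⁻¹) ^ 2)) • Yop (Sum.inr (i, j)) v (Phi ρ x) =
      (c x : ℂ) * (‖x‖ : ℂ)⁻¹ ^ 2 * (1 + ρ * (‖x‖ : ℂ)⁻¹) * ((‖x‖ : ℂ)^2 * e j - x j * L x) := by
    rw [hLx, ← hsq, Finset.sum_mul, Finset.mul_sum, ← Finset.sum_sub_distrib, Finset.mul_sum]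
    refine Finset.sum_congr rfl fun i _ => ?_
    simp only [Yop, ← hL, Complex.real_smul]
    simp only [he, Phi, PiLp.smul_apply, smul_eq_mul]
    push_cast
    ring
  rw [s1, s2]
  have s3 : (L.comp ((1 + ρ * ‖x‖⁻¹) • ContinuousLinearMap.id ℝ (Euc n) + (ρ • (-(‖x‖ ^ 2)⁻¹) • N).smulRight x)) (EuclideanSpace.single j 1)
      = (1 + ρ * (‖x‖ : ℂ)⁻¹) * e j - ρ * (‖x‖ : ℂ)⁻¹ ^ 3 * x j * L x := by
    simp [hNj, he]
    ring
  simp only [_root_.add_apply, _root_.smul_apply, ContinuousLinearMap.smulRight_apply]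
  erw [s3]
  simp only [Complex.real_smul, Function.comp]
  field_simp
  ring

open LineDeriv in
lemma Dk_succ {n : ℕ} (j : Fin n) (k : ℕ) (f : SchwartzMap (Euc n) ℂ) :
    Dk j (k+1) f = Dk j k (∂_{(EuclideanSpace.single j (1:ℝ) : Euc n)} f) := by
  simp [Dk]

open LineDeriv in
lemma Dk_add {n : ℕ} (j : Fin n) (k : ℕ) (f g : SchwartzMap (Euc n) ℂ) :
    Dk j k (f + g) = Dk j k f + Dk j k g := by
  induction k generalizing f g with
  | zero => simp [Dk]
  | succ k ih => rw [Dk_succ, Dk_succ, Dk_succ, lineDerivOp_add, ih]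

lemma Dk_sum {n : ℕ} (j : Fin n) (k : ℕ) (f : Fin n → SchwartzMap (Euc n) ℂ) :
    Dk j k (∑ i, f i) = ∑ i, Dk j k (f i) :=
  map_sum (AddMonoidHom.mk' (Dk j k) (Dk_add j k)) f Finset.univ

lemma contDiffAt_coord {n : ℕ} (j : Fin n) (x : Euc n) : ContDiffAt ℝ (⊤ : ℕ∞) (fun x : Euc n => x j) x :=
  (EuclideanSpace.proj (𝕜 := ℝ) j).contDiff.contDiffAt

open LineDeriv in
lemma Dk_bound {n : ℕ} (j : Fin n) (k : ℕ) (c : Euc n → ℝ) (hc : GoodC c) :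
    ∃ C : ℝ, 0 ≤ C ∧ ∀ (ρ : ℝ) (v : Euc n → ℂ), ContDiff ℝ (⊤ : ℕ∞) v →
      ∀ f : SchwartzMap (Euc n) ℂ, (∀ x, f x = c x • v (Phi ρ x)) → ∀ x,
        ‖Dk j k f x‖ ≤ C * ((Ann n).indicator (fun _ => (1:ℝ)) x * NN k v (Phi ρ x)) := by
  induction k generalizing c with
  | zero =>
    obtain ⟨C, hC0, hC⟩ := hc.bound
    refine ⟨C, hC0, fun ρ v hv f hf x => ?_⟩
    simp only [Dk, Function.iterate_zero, id, hf, norm_smul, NN, Real.norm_eq_abs]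
    rw [← mul_assoc]
    gcongr
    exact hC x
  | succ k ih =>
    have g0 := hc.deriv (EuclideanSpace.single j (1:ℝ))
    have g1 (i : Fin n) : GoodC (fun x => c x * (x j * x i * (‖x‖⁻¹) ^ 2)) :=
      hc.mul fun x hx => ((contDiffAt_coord j x).mul (contDiffAt_coord i x)).mul ((contDiffAt_inv_norm hx).pow 2)
    have g2 (i : Fin n) : GoodC (fun x => c x * (x i * (‖x‖⁻¹) ^ 2)) :=
      hc.mul fun x hx => (contDiffAt_coord i x).mul ((contDiffAt_inv_norm hx).pow 2)
    obtain ⟨C0, hC0, h0⟩ := ih _ g0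
    choose C1 hC1 h1 using fun i => ih _ (g1 i)
    choose C2 hC2 h2 using fun i => ih _ (g2 i)
    refine ⟨C0 + ∑ i, C1 i + ∑ i, C2 i, add_nonneg (add_nonneg hC0 (Finset.sum_nonneg fun i _ => hC1 i))
      (Finset.sum_nonneg fun i _ => hC2 i), fun ρ v hv f hf x => ?_⟩
    obtain ⟨f0, hf0⟩ := exists_schwartz g0 ρ hv
    choose f1 hf1 using fun i => exists_schwartz (g1 i) ρ (Yop_smooth hv (Sum.inl i))
    choose f2 hf2 using fun i => exists_schwartz (g2 i) ρ (Yop_smooth hv (Sum.inr (i, j)))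
    have hD : ∂_{(EuclideanSpace.single j (1:ℝ) : Euc n)} f = f0 + ∑ i, f1 i + ∑ i, f2 i := by
      ext y
      have hff : (f : Euc n → ℂ) = fun x => c x • v (Phi ρ x) := funext hf
      rw [SchwartzMap.lineDerivOp_apply_eq_fderiv, hff, fderiv_term hc ρ hv]
      simp only [_root_.add_apply, _root_.sum_apply, hf0, hf1, hf2]
    have hI : 0 ≤ (Ann n).indicator (fun _ => (1:ℝ)) x := indicator_nonneg (fun _ _ => zero_le_one) x
    rw [Dk_succ, hD, Dk_add, Dk_add, Dk_sum, Dk_sum]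
    simp only [_root_.add_apply, _root_.sum_apply]
    rw [add_mul, add_mul, Finset.sum_mul, Finset.sum_mul]
    refine (norm_add_le _ _).trans (add_le_add ((norm_add_le _ _).trans (add_le_add ?_ ?_)) ?_)
    · refine (h0 ρ v hv f0 hf0 x).trans ?_
      gcongr
      exact NN_mono _ _ _
    · refine (norm_sum_le _ _).trans (Finset.sum_le_sum fun i _ => ?_)
      refine (h1 i ρ _ (Yop_smooth hv _) (f1 i) (hf1 i) x).trans ?_
      have := hC1 i
      gcongr
      exact NN_Yop _ _ _ _
    · refine (norm_sum_le _ _).trans (Finset.sum_le_sum fun i _ => ?_)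
      refine (h2 i ρ _ (Yop_smooth hv _) (f2 i) (hf2 i) x).trans ?_
      have := hC2 i
      gcongr
      exact NN_Yop _ _ _ _

lemma NN_eq {n : ℕ} (k : ℕ) (v : Euc n → ℂ) (y : Euc n) :
    NN k v y = ∑ m ∈ Finset.range (k+1), ∑ ops : Fin m → YIdx n, ‖Yapply ops v y‖ := by
  induction k generalizing v with
  | zero => simp [NN, Yapply]
  | succ k ih =>
    rw [Finset.sum_range_succ', NN, add_comm]
    congr 1
    · simp only [ih]
      rw [Finset.sum_comm]
      refine Finset.sum_congr rfl fun m _ => ?_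
      rw [← (Fin.snocEquiv (fun _ : Fin (m+1) => YIdx n)).sum_comp, Fintype.sum_prod_type]
      refine Finset.sum_congr rfl fun i _ => Finset.sum_congr rfl fun ops _ => ?_
      have : Yapply ((Fin.snocEquiv (fun _ : Fin (m+1) => YIdx n)) (i, ops)) v = Yapply ops (Yop i v) := by
        unfold Yapply
        rw [List.ofFn_succ']
        simp [List.concat_eq_append, Fin.snocEquiv]
      rw [this]
    · simp [Yapply]

lemma Yapply_smooth {n m : ℕ} (ops : Fin m → YIdx n) {u : Euc n → ℂ} (hu : ContDiff ℝ (⊤ : ℕ∞) u) :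
    ContDiff ℝ (⊤ : ℕ∞) (Yapply ops u) := by
  unfold Yapply
  induction List.ofFn ops with
  | nil => simpa
  | cons a l ih => exact Yop_smooth ih a

lemma exists_cutoff (n : ℕ) : ∃ χ : Euc n → ℝ, GoodC χ ∧ ∀ x, ‖x‖ = 2 → χ x = 1 := by
  let ψ : ContDiffBump (4:ℝ) := ⟨1/2, 1, by norm_num, by norm_num⟩
  refine ⟨fun x => ψ (‖x‖ ^ 2), ⟨ψ.contDiff.comp (contDiff_norm_sq ℝ), fun x hx => ?_⟩, fun x hx => ?_⟩
  · apply ψ.zero_of_le_dist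
    by_contra h
    push Not at h
    rw [Real.dist_eq, abs_lt] at h
    have h' : (-1 < ‖x‖^2 - 4) ∧ (‖x‖^2 - 4 < 1) := h
    have := norm_nonneg x
    exact hx ⟨by nlinarith, by nlinarith⟩
  · apply ψ.one_of_mem_closedBall
    simp only [hx]
    norm_num

lemma lintegral_polar {n : ℕ} (hn : 2 ≤ n) (f : Euc n → ℝ≥0∞) (hf : Measurable f) :
    ∫⁻ x, f x = ∫⁻ s in Ioi (0:ℝ), ENNReal.ofReal (s ^ (n-1)) * ∫⁻ ω, f (s • ω.val) ∂(sphMeas n) := by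
  have : Nontrivial (Euc n) := by
    apply Module.nontrivial_of_finrank_pos (R := ℝ)
    simp; omega
  have hm : Measurable fun p : sphere (0 : Euc n) 1 × Ioi (0:ℝ) => f (p.2.1 • p.1.1) :=
    hf.comp (by fun_prop)
  have hm2 : Measurable fun s : Ioi (0:ℝ) => ∫⁻ ω, f (s.1 • ω.val) ∂(sphMeas n) := by
    unfold sphMeas
    exact hm.lintegral_prod_left'
  have h1 : ∫⁻ x, f x = ∫⁻ x : ({(0)}ᶜ : Set (Euc n)), f x.1 ∂((volume : Measure (Euc n)).comap (↑)) := by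
    rw [lintegral_subtype_comap (measurableSet_singleton _).compl f, restrict_compl_singleton]
  have h2 : ∫⁻ x : ({(0)}ᶜ : Set (Euc n)), f x.1 ∂((volume : Measure (Euc n)).comap (↑)) =
      ∫⁻ p, f (p.2.1 • p.1.1) ∂((volume : Measure (Euc n)).toSphere.prod (.volumeIoiPow (Module.finrank ℝ (Euc n) - 1))) := by
    rw [← (volume : Measure (Euc n)).measurePreserving_homeomorphUnitSphereProd.lintegral_comp hm]
    refine lintegral_congr fun x => ?_
    congr 1
    have hx : ‖x.1‖ ≠ 0 := norm_ne_zero_iff.2 x.2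
    simp [smul_smul, hx]
  rw [h1, h2, lintegral_prod_symm' _ hm, Measure.volumeIoiPow]
  simp only [sphMeas] at hm2 ⊢
  rw [lintegral_withDensity_eq_lintegral_mul _ (by fun_prop) hm2,
    ← lintegral_subtype_comap measurableSet_Ioi]
  simp

lemma L2sph_sq {n : ℕ} (g : sphere (0 : Euc n) 1 → ℂ) :
    L2sph g ^ (2:ℝ) = ∫⁻ ω, ‖g ω‖ₑ ^ (2:ℝ) ∂(sphMeas n) := by
  unfold L2sph
  rw [← ENNReal.rpow_mul]
  norm_num
  rfl

lemma polar_Ann {n : ℕ} (hn : 2 ≤ n) (ρ : ℝ) (v : Euc n → ℂ) (hv : Continuous v) :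
    eLpNorm (fun x => (Ann n).indicator (fun _ => (1:ℝ)) x * ‖v (Phi ρ x)‖) 2 volume ≤
      ENNReal.ofReal ((5/2) ^ (n-1)) ^ (1/2:ℝ) *
      (∫⁻ s in Icc (3/2 + ρ) (5/2 + ρ), L2sph (fun ω => v (s • ω.val)) ^ (2:ℝ)) ^ (1/2:ℝ) := by
  have hPm : Measurable (Phi ρ : Euc n → Euc n) := by unfold Phi; fun_prop
  rw [eLpNorm_eq_lintegral_rpow_enorm_toReal (by norm_num) (by norm_num)]
  simp only [ENNReal.toReal_ofNat]
  rw [← ENNReal.mul_rpow_of_nonneg _ _ (by norm_num)]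
  gcongr
  have hvm : Measurable fun x => ‖v (Phi ρ x)‖ := hv.norm.measurable.comp hPm
  have him : Measurable ((Ann n).indicator (fun _ => (1:ℝ))) :=
    measurable_const.indicator (isClosed_Ann n).measurableSet
  rw [lintegral_polar hn _ (by fun_prop)]
  have hsh : ∫⁻ s in Icc (3/2 + ρ) (5/2 + ρ), L2sph (fun ω => v (s • ω.val)) ^ (2:ℝ) =
      ∫⁻ s in Icc (3/2:ℝ) (5/2), L2sph (fun ω => v ((s + ρ) • ω.val)) ^ (2:ℝ) := by
    have := (measurePreserving_add_right volume ρ).setLIntegral_comp_preimage_emb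
      (MeasurableEquiv.addRight ρ).measurableEmbedding (fun s => L2sph (fun ω => v (s • ω.val)) ^ (2:ℝ)) (Icc (3/2 + ρ) (5/2 + ρ))
    rw [← this]
    simp
  rw [hsh, ← lintegral_const_mul' _ _ ENNReal.ofReal_ne_top, ← lintegral_indicator measurableSet_Ioi,
    ← lintegral_indicator measurableSet_Icc]
  refine lintegral_mono fun s => ?_
  by_cases hs : s ∈ Icc (3/2:ℝ) (5/2)
  · have hs0 : 0 < s := by linarith [hs.1]
    simp only [hs, indicator_of_mem, mem_Ioi, hs0, L2sph_sq]
    gcongr with ω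
    · exact hs.2
    · have hω : ‖ω.1‖ = 1 := by simp
      have hns : ‖s • ω.1‖ = s := by rw [norm_smul, hω, Real.norm_of_nonneg hs0.le, mul_one]
      have hP : Phi ρ (s • ω.1) = (s + ρ) • ω.1 := by
        rw [Phi, hns, smul_smul]
        congr 1
        field_simp
      rw [hP]
      have : (s • ω.1) ∈ Ann n := by simp only [Ann, mem_ofPred_eq, hns]; exact hs
      simp [this]
  · by_cases hs0 : s ∈ Ioi (0:ℝ)
    · simp only [hs, hs0, indicator_of_mem, indicator_of_notMem, not_false_eq_true, nonpos_iff_eq_zero]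
      have h0 : ∀ ω : sphere (0 : Euc n) 1, (Ann n).indicator (fun _ => (1:ℝ)) (s • ω.1) = 0 := by
        intro ω
        have hω : ‖ω.1‖ = 1 := by simp
        have hns : ‖s • ω.1‖ = s := by rw [norm_smul, hω, Real.norm_of_nonneg (le_of_lt hs0), mul_one]
        rw [indicator_of_notMem]
        simp only [Ann, mem_ofPred_eq, hns]; exact hs
      simp [h0]
    · simp [hs0]

lemma local_sobolev (n : ℕ) (hn : 2 ≤ n) : ∃ C : ℝ≥0, ∀ u : Euc n → ℂ, ContDiff ℝ (⊤ : ℕ∞) u →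
    ∀ (ρ : ℝ) (ω : sphere (0 : Euc n) 1), ‖u ((2 + ρ) • ω.val)‖ₑ ≤
      C * ∑ m ∈ Finset.range ((n+2)/2 + 1), ∑ ops : Fin m → YIdx n,
        (∫⁻ s in Icc (3/2 + ρ) (5/2 + ρ), L2sph (fun ω => Yapply ops u (s • ω.val)) ^ (2:ℝ)) ^ (1/2:ℝ) := by
  set k := (n+2)/2 with hk
  obtain ⟨χ, hχ, hχ1⟩ := exists_cutoff n
  obtain ⟨C0, hC0⟩ := sobolev_schwartz n k (by omega)
  obtain ⟨C1, hC1p, hC1⟩ := hχ.bound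
  choose C2 hC2p hC2 using fun j => Dk_bound j k χ hχ
  set B : ℝ≥0∞ := ENNReal.ofReal ((5/2) ^ (n-1)) ^ (1/2:ℝ) with hB
  have hBt : B ≠ ∞ := (ENNReal.rpow_lt_top_of_nonneg (by norm_num) ENNReal.ofReal_ne_top).ne
  have hbig : (C0 : ℝ≥0∞) * ((ENNReal.ofReal C1 + ∑ j, ENNReal.ofReal (C2 j)) * B) ≠ ∞ := by
    refine ENNReal.mul_ne_top ENNReal.coe_ne_top (ENNReal.mul_ne_top ?_ hBt)
    exact ENNReal.add_ne_top.2 ⟨ENNReal.ofReal_ne_top, ENNReal.sum_ne_top.2 fun _ _ => ENNReal.ofReal_ne_top⟩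
  refine ⟨((C0 : ℝ≥0∞) * ((ENNReal.ofReal C1 + ∑ j, ENNReal.ofReal (C2 j)) * B)).toNNReal, fun u hu ρ ω => ?_⟩
  rw [ENNReal.coe_toNNReal hbig]
  obtain ⟨f, hf⟩ := exists_schwartz hχ ρ hu
  have hω : ‖ω.1‖ = 1 := by simp
  have hns : ‖(2:ℝ) • ω.1‖ = 2 := by rw [norm_smul, hω]; norm_num
  have hP : Phi ρ ((2:ℝ) • ω.1) = (2 + ρ) • ω.1 := by
    rw [Phi, hns, smul_smul]; congr 1; ring
  have h1 := hC0 f ((2:ℝ) • ω.1)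
  rw [hf, hP, hχ1 _ hns, one_smul] at h1
  refine h1.trans ?_
  rw [mul_assoc]
  gcongr
  have hI : ∀ x, 0 ≤ (Ann n).indicator (fun _ => (1:ℝ)) x := fun x => indicator_nonneg (fun _ _ => zero_le_one) x
  set T := eLpNorm (fun x => (Ann n).indicator (fun _ => (1:ℝ)) x * NN k u (Phi ρ x)) 2 volume with hT
  have h2 : eLpNorm f 2 volume ≤ ENNReal.ofReal C1 * T := by
    refine eLpNorm_le_mul_eLpNorm_of_ae_le_mul (Filter.Eventually.of_forall fun x => ?_) 2
    rw [hf, norm_smul, Real.norm_of_nonneg (mul_nonneg (hI x) (NN_nonneg _ _ _)), ← mul_assoc]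
    have hu0 : ‖u (Phi ρ x)‖ ≤ NN k u (Phi ρ x) := by
      cases k with
      | zero => simp [NN]
      | succ k => rw [NN]; exact le_add_of_nonneg_right (Finset.sum_nonneg fun i _ => NN_nonneg _ _ _)
    refine mul_le_mul (hC1 x) hu0 (norm_nonneg _) (mul_nonneg hC1p (hI x))
  have h3 : ∀ j, eLpNorm (Dk j k f) 2 volume ≤ ENNReal.ofReal (C2 j) * T := fun j => by
    refine eLpNorm_le_mul_eLpNorm_of_ae_le_mul (Filter.Eventually.of_forall fun x => ?_) 2
    rw [Real.norm_of_nonneg (mul_nonneg (hI x) (NN_nonneg _ _ _))]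
    exact hC2 j ρ u hu f hf x
  have h4 : T ≤ B * ∑ m ∈ Finset.range (k + 1), ∑ ops : Fin m → YIdx n,
        (∫⁻ s in Icc (3/2 + ρ) (5/2 + ρ), L2sph (fun ω => Yapply ops u (s • ω.val)) ^ (2:ℝ)) ^ (1/2:ℝ) := by
    have hPm : Measurable (Phi ρ : Euc n → Euc n) := by unfold Phi; fun_prop
    have him : Measurable ((Ann n).indicator (fun _ => (1:ℝ))) :=
      measurable_const.indicator (isClosed_Ann n).measurableSet
    have hm : ∀ (m : ℕ) (ops : Fin m → YIdx n), Measurable fun x => (Ann n).indicator (fun _ => (1:ℝ)) x * ‖Yapply ops u (Phi ρ x)‖ :=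
      fun m ops => him.mul ((Yapply_smooth ops hu).continuous.norm.measurable.comp hPm)
    have e1 : (fun x => (Ann n).indicator (fun _ => (1:ℝ)) x * NN k u (Phi ρ x)) =
        ∑ m ∈ Finset.range (k+1), ∑ ops : Fin m → YIdx n, fun x => (Ann n).indicator (fun _ => (1:ℝ)) x * ‖Yapply ops u (Phi ρ x)‖ := by
      ext x
      simp only [NN_eq, Finset.sum_apply, Finset.mul_sum]
    rw [hT, e1]
    refine (eLpNorm_sum_le (fun m _ => ?_) (by norm_num)).trans ?_
    · exact Finset.aestronglyMeasurable_sum _ fun ops _ => (hm m ops).aestronglyMeasurable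
    rw [Finset.mul_sum]
    refine Finset.sum_le_sum fun m _ => ?_
    refine (eLpNorm_sum_le (fun ops _ => (hm m ops).aestronglyMeasurable) (by norm_num)).trans ?_
    rw [Finset.mul_sum]
    exact Finset.sum_le_sum fun ops _ => polar_Ann hn ρ _ (Yapply_smooth ops hu).continuous
  calc eLpNorm f 2 volume + ∑ j, eLpNorm (Dk j k f) 2 volume
      ≤ ENNReal.ofReal C1 * T + ∑ j, ENNReal.ofReal (C2 j) * T := add_le_add h2 (Finset.sum_le_sum fun j _ => h3 j)
    _ = (ENNReal.ofReal C1 + ∑ j, ENNReal.ofReal (C2 j)) * T := by rw [add_mul, Finset.sum_mul]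
    _ ≤ _ := by rw [mul_assoc]; gcongr

lemma minkowski_sum {α ι : Type*} [MeasurableSpace α] (μ : Measure α) (q : ℝ) (hq : 1 ≤ q) (s : Finset ι)
    (H : ι → α → ℝ≥0∞) (hH : ∀ i, Measurable (H i)) :
    (∫⁻ r, (∑ i ∈ s, H i r) ^ q ∂μ) ^ (1/q) ≤ ∑ i ∈ s, (∫⁻ r, H i r ^ q ∂μ) ^ (1/q) := by
  classical
  induction s using Finset.induction_on with
  | empty =>
    have : 0 < q := by linarith
    simp [this]
  | insert a s ha ih =>
    simp only [Finset.sum_insert ha]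
    have := ENNReal.lintegral_Lp_add_le (μ := μ) (f := H a) (g := fun r => ∑ i ∈ s, H i r)
      (hH a).aemeasurable (Finset.measurable_fun_sum _ fun i _ => hH i).aemeasurable hq
    refine this.trans ?_
    gcongr

/-- Window integral. -/
def Win (h : ℝ → ℝ≥0∞) (r : ℝ) : ℝ≥0∞ := ∫⁻ s in Icc (r - 1/2) (r + 1/2), h s

lemma Win_eq (h : ℝ → ℝ≥0∞) (r : ℝ) :
    Win h r = ∫⁻ s, ({p : ℝ × ℝ | p.1 - 1/2 ≤ p.2 ∧ p.2 ≤ p.1 + 1/2}.indicator (fun p => h p.2)) (r, s) := by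
  rw [Win, ← lintegral_indicator measurableSet_Icc]
  rfl

lemma Win_aux {h : ℝ → ℝ≥0∞} (hh : Measurable h) :
    Measurable ({p : ℝ × ℝ | p.1 - 1/2 ≤ p.2 ∧ p.2 ≤ p.1 + 1/2}.indicator (fun p => h p.2)) := by
  refine (hh.comp measurable_snd).indicator ?_
  have h1 : MeasurableSet {p : ℝ × ℝ | p.1 - 1/2 ≤ p.2} := measurableSet_le (by fun_prop) (by fun_prop)
  have h2 : MeasurableSet {p : ℝ × ℝ | p.2 ≤ p.1 + 1/2} := measurableSet_le (by fun_prop) (by fun_prop)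
  exact h1.inter h2

lemma Win_measurable {h : ℝ → ℝ≥0∞} (hh : Measurable h) : Measurable (Win h) := by
  have : Win h = fun r => ∫⁻ s, ({p : ℝ × ℝ | p.1 - 1/2 ≤ p.2 ∧ p.2 ≤ p.1 + 1/2}.indicator (fun p => h p.2)) (r, s) :=
    funext (Win_eq h)
  rw [this]
  exact (Win_aux hh).lintegral_prod_right'

lemma Win_integral {h : ℝ → ℝ≥0∞} (hh : Measurable h) : ∫⁻ r, Win h r = ∫⁻ s, h s := by
  simp only [Win_eq]
  rw [lintegral_lintegral_swap (f := fun r s =>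
    ({p : ℝ × ℝ | p.1 - 1/2 ≤ p.2 ∧ p.2 ≤ p.1 + 1/2}.indicator (fun p => h p.2)) (r, s)) (Win_aux hh).aemeasurable]
  refine lintegral_congr fun s => ?_
  have : (fun r => ({p : ℝ × ℝ | p.1 - 1/2 ≤ p.2 ∧ p.2 ≤ p.1 + 1/2}.indicator (fun p => h p.2)) (r, s)) =
      (Icc (s - 1/2) (s + 1/2)).indicator (fun _ => h s) := by
    ext r
    simp only [indicator, mem_ofPred_eq, mem_Icc]
    congr 1
    apply propext
    constructor <;> rintro ⟨h1, h2⟩ <;> constructor <;> linarith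
  rw [this, lintegral_indicator measurableSet_Icc]
  simp
  norm_num

lemma window_core {G : ℝ → ℝ≥0∞} (hG : Measurable G) {p q R : ℝ} (hp : 1 ≤ p) (hpq : p ≤ q) :
    (∫⁻ r in Ioi (R+1), (Win (fun s => G s ^ p) r ^ (1/p)) ^ q) ^ (1/q) ≤ (∫⁻ s in Ioi R, G s ^ p) ^ (1/p) := by
  have hp0 : 0 < p := by linarith
  have hq0 : 0 < q := by linarith
  set h : ℝ → ℝ≥0∞ := (Ioi R).indicator (fun s => G s ^ p) with hh
  have hhm : Measurable h := (hG.pow_const p).indicator measurableSet_Ioi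
  set X := ∫⁻ s in Ioi R, G s ^ p with hX
  have hXh : X = ∫⁻ s, h s := by rw [hX, hh, lintegral_indicator measurableSet_Ioi]
  have hJ : ∀ r ∈ Ioi (R+1), Win (fun s => G s ^ p) r = Win h r := by
    intro r hr
    simp only [mem_Ioi] at hr
    refine setLIntegral_congr_fun measurableSet_Icc fun s hs => ?_
    have : s ∈ Ioi R := by simp only [mem_Ioi]; linarith [hs.1]
    simp [hh, indicator_of_mem this]
  have hle : ∀ r, Win h r ≤ X := fun r => by rw [hXh]; exact setLIntegral_le_lintegral _ _
  have hqp : 0 ≤ q/p - 1 := by rw [sub_nonneg, one_le_div hp0]; exact hpq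
  have key : ∫⁻ r in Ioi (R+1), (Win (fun s => G s ^ p) r ^ (1/p)) ^ q ≤ X ^ (q/p) := by
    calc ∫⁻ r in Ioi (R+1), (Win (fun s => G s ^ p) r ^ (1/p)) ^ q
        ≤ ∫⁻ r in Ioi (R+1), X ^ (q/p-1) * Win h r := by
          refine setLIntegral_mono ((Win_measurable hhm).const_mul _) fun r hr => ?_
          rw [hJ r hr, ← ENNReal.rpow_mul, show 1/p*q = (q/p-1) + 1 by ring, ENNReal.rpow_add_of_nonneg _ _ hqp zero_le_one,
            ENNReal.rpow_one]
          gcongr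
          exact hle r
      _ ≤ ∫⁻ r, X ^ (q/p-1) * Win h r := setLIntegral_le_lintegral _ _
      _ = X ^ (q/p-1) * X := by
          rw [lintegral_const_mul _ (Win_measurable hhm), Win_integral hhm, ← hXh]
      _ = X ^ (q/p) := by
          conv_rhs => rw [show q/p = (q/p-1) + 1 by ring, ENNReal.rpow_add_of_nonneg _ _ hqp zero_le_one,
            ENNReal.rpow_one]
  calc _ ≤ (X ^ (q/p)) ^ (1/q) := by gcongr
    _ = X ^ (1/p) := by
      rw [← ENNReal.rpow_mul]; congr 1; field_simp

lemma window_holder {G : ℝ → ℝ≥0∞} (hG : Measurable G) {p : ℝ} (hp : 2 ≤ p) (r : ℝ) :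
    Win (fun s => G s ^ (2:ℝ)) r ^ (1/2:ℝ) ≤ Win (fun s => G s ^ p) r ^ (1/p) := by
  have : IsProbabilityMeasure (volume.restrict (Icc (r - 1/2) (r + 1/2))) := ⟨by simp; norm_num⟩
  have := eLpNorm'_le_eLpNorm'_of_exponent_le (f := G) (p := 2) (q := p) (by norm_num) hp
    (volume.restrict (Icc (r - 1/2) (r + 1/2))) hG.aestronglyMeasurable
  simpa [eLpNorm', Win] using this

lemma window_weight {g : ℝ → ℝ≥0∞} {a r : ℝ} (hr : 1 ≤ r) :
    ENNReal.ofReal (r ^ a) * Win (fun s => g s ^ (2:ℝ)) r ^ (1/2:ℝ) ≤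
      ENNReal.ofReal (2 ^ |a|) * Win (fun s => (ENNReal.ofReal (s ^ a) * g s) ^ (2:ℝ)) r ^ (1/2:ℝ) := by
  have e (x y : ℝ≥0∞) : x * y ^ (1/2:ℝ) = (x ^ (2:ℝ) * y) ^ (1/2:ℝ) := by
    rw [ENNReal.mul_rpow_of_nonneg _ _ (by norm_num), ← ENNReal.rpow_mul]; norm_num
  rw [e, e]
  refine ENNReal.rpow_le_rpow ?_ (by norm_num)
  unfold Win
  rw [← lintegral_const_mul' _ _ (by simp), ← lintegral_const_mul' _ _ (by simp)]
  refine setLIntegral_mono' measurableSet_Icc fun s hs => ?_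
  rw [← ENNReal.mul_rpow_of_nonneg _ _ (by norm_num), ← ENNReal.mul_rpow_of_nonneg _ _ (by norm_num), ← mul_assoc,
    ← ENNReal.ofReal_mul (by positivity)]
  have hs0 : 0 < s := by linarith [hs.1]
  have hr0 : 0 < r := by linarith
  gcongr
  have h1 : r / s ≤ 2 := by rw [div_le_iff₀ hs0]; linarith [hs.1]
  have h2 : s / r ≤ 2 := by rw [div_le_iff₀ hr0]; linarith [hs.2]
  have h3 : (r / s) ^ a ≤ 2 ^ |a| := by
    rcases le_total 0 a with ha | ha
    · rw [abs_of_nonneg ha]; exact Real.rpow_le_rpow (by positivity) h1 ha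
    · rw [abs_of_nonpos ha, ← inv_div, Real.inv_rpow (by positivity), ← Real.rpow_neg (by positivity)]
      exact Real.rpow_le_rpow (by positivity) h2 (by linarith)
  rw [Real.div_rpow hr0.le hs0.le, div_le_iff₀ (by positivity)] at h3
  exact h3

lemma L2sph_measurable {n : ℕ} {v : Euc n → ℂ} (hv : Continuous v) :
    Measurable fun s : ℝ => L2sph (fun ω => v (s • ω.val)) := by
  unfold L2sph sphMeas
  refine Measurable.pow_const ?_ _
  have : Measurable fun p : ℝ × sphere (0 : Euc n) 1 => (‖v (p.1 • p.2.val)‖₊ : ℝ≥0∞) ^ (2:ℝ) := by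
    refine Measurable.pow_const ?_ _
    have : Continuous fun p : ℝ × sphere (0 : Euc n) 1 => v (p.1 • p.2.val) := by fun_prop
    exact this.nnnorm.measurable.coe_nnreal_ennreal
  exact this.lintegral_prod_right'

lemma LqrNorm_p {n : ℕ} {p R e b : ℝ} (hp : 2 ≤ p) (hR : 3 ≤ R) (g : ℝ → ℝ≥0∞) :
    LqrNorm n (ENNReal.ofReal p) R (fun r => ENNReal.ofReal (r ^ (b - ((n:ℝ)-1)/p + e)) * g r) =
      (∫⁻ s in Ioi R, (ENNReal.ofReal (s ^ (b + e)) * g s) ^ p) ^ (1/p) := by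
  have hp0 : 0 < p := by linarith
  rw [LqrNorm, if_neg ENNReal.ofReal_ne_top, ENNReal.toReal_ofReal hp0.le]
  congr 1
  refine setLIntegral_congr_fun measurableSet_Ioi fun s hs => ?_
  have hs0 : 0 < s := by simp only [mem_Ioi] at hs; linarith
  rw [ENNReal.mul_rpow_of_nonneg _ _ hp0.le, ENNReal.mul_rpow_of_nonneg _ _ hp0.le, mul_right_comm]
  congr 1
  rw [ENNReal.ofReal_rpow_of_nonneg (by positivity) hp0.le, ENNReal.ofReal_rpow_of_nonneg (by positivity) hp0.le,
    ← ENNReal.ofReal_mul (by positivity), ← Real.rpow_mul hs0.le, ← Real.rpow_mul hs0.le, ← Real.rpow_add hs0]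
  congr 2
  field_simp
  ring

/-- Weighted Sobolev estimate in polar coordinates: for `n ≥ 2`, `R ≥ 3`,
`b ∈ ℝ`, `2 ≤ p ≤ q ≤ ∞`:
`‖ r^b u ‖_{L^q_r L^∞_ω (r ≥ R+1)} ≲ ‖ r^{b-(n-1)/p+(n-1)/q} Y^{≤⌊(n+2)/2⌋} u ‖_{L^p_r L^2_ω (r ≥ R)}`. -/
theorem weighted_sobolev_polar (n : ℕ) (hn : 2 ≤ n) (R : ℝ) (hR : 3 ≤ R)
    (b : ℝ) (p : ℝ) (q : ℝ≥0∞) (hp : 2 ≤ p) (hpq : ENNReal.ofReal p ≤ q) :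
    ∃ C : ℝ≥0, ∀ u : Euc n → ℂ, ContDiff ℝ (⊤ : ℕ∞) u →
      LqrNorm n q (R + 1)
          (fun r => ENNReal.ofReal (r ^ b) * ⨆ ω : sphere (0 : Euc n) 1, (‖u (r • ω.val)‖₊ : ℝ≥0∞)) ≤
        (C : ℝ≥0∞) * ∑ m ∈ Finset.range ((n+2)/2 + 1), ∑ ops : Fin m → YIdx n,
          LqrNorm n (ENNReal.ofReal p) R
            (fun r => ENNReal.ofReal (r ^ (b - ((n:ℝ)-1)/p + ((n:ℝ)-1)/q.toReal)) *
              L2sph (fun ω => Yapply ops u (r • ω.val))) := by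
  have hp0 : 0 < p := by linarith
  obtain ⟨C, hC⟩ := local_sobolev n hn
  set e := ((n:ℝ)-1)/q.toReal with he
  have hK : (C : ℝ≥0∞) * ENNReal.ofReal (2 ^ |b + e|) ≠ ∞ := ENNReal.mul_ne_top ENNReal.coe_ne_top ENNReal.ofReal_ne_top
  refine ⟨((C : ℝ≥0∞) * ENNReal.ofReal (2 ^ |b + e|)).toNNReal, fun u hu => ?_⟩
  rw [ENNReal.coe_toNNReal hK]
  simp only [LqrNorm_p hp hR]
  set K := (C : ℝ≥0∞) * ENNReal.ofReal (2 ^ |b + e|) with hKdef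
  set G : (m : ℕ) → (Fin m → YIdx n) → ℝ → ℝ≥0∞ := fun m ops s =>
    ENNReal.ofReal (s ^ (b + e)) * L2sph (fun ω => Yapply ops u (s • ω.val)) with hGdef
  have hGm : ∀ m ops, Measurable (G m ops) := fun m ops =>
    Measurable.mul (by fun_prop) (L2sph_measurable (Yapply_smooth ops hu).continuous)
  have main : ∀ r, R + 1 < r → ENNReal.ofReal (r ^ (b + e)) * (⨆ ω : sphere (0 : Euc n) 1, (‖u (r • ω.val)‖₊ : ℝ≥0∞)) ≤
      K * ∑ m ∈ Finset.range ((n+2)/2 + 1), ∑ ops : Fin m → YIdx n, Win (fun s => G m ops s ^ p) r ^ (1/p) := by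
    intro r hr
    have h1 : (⨆ ω : sphere (0 : Euc n) 1, (‖u (r • ω.val)‖₊ : ℝ≥0∞)) ≤
        C * ∑ m ∈ Finset.range ((n+2)/2 + 1), ∑ ops : Fin m → YIdx n,
          Win (fun s => L2sph (fun ω => Yapply ops u (s • ω.val)) ^ (2:ℝ)) r ^ (1/2:ℝ) := by
      refine iSup_le fun ω => ?_
      have := hC u hu (r - 2) ω
      rw [show 2 + (r - 2) = r by ring, show 3/2 + (r - 2) = r - 1/2 by ring, show 5/2 + (r - 2) = r + 1/2 by ring] at this
      exact this
    calc _ ≤ ENNReal.ofReal (r ^ (b + e)) * (C * ∑ m ∈ Finset.range ((n+2)/2 + 1), ∑ ops : Fin m → YIdx n,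
          Win (fun s => L2sph (fun ω => Yapply ops u (s • ω.val)) ^ (2:ℝ)) r ^ (1/2:ℝ)) := by gcongr
      _ = C * ∑ m ∈ Finset.range ((n+2)/2 + 1), ∑ ops : Fin m → YIdx n, ENNReal.ofReal (r ^ (b + e)) *
          Win (fun s => L2sph (fun ω => Yapply ops u (s • ω.val)) ^ (2:ℝ)) r ^ (1/2:ℝ) := by
        rw [mul_left_comm]; simp only [Finset.mul_sum]
      _ ≤ C * ∑ m ∈ Finset.range ((n+2)/2 + 1), ∑ ops : Fin m → YIdx n, ENNReal.ofReal (2 ^ |b + e|) *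
          Win (fun s => G m ops s ^ p) r ^ (1/p) := by
        refine mul_le_mul' le_rfl (Finset.sum_le_sum fun m _ => Finset.sum_le_sum fun ops _ => ?_)
        refine (window_weight (by linarith)).trans ?_
        exact mul_le_mul' le_rfl (window_holder (hGm m ops) hp r)
      _ = _ := by rw [hKdef, mul_assoc]; simp only [Finset.mul_sum]
  by_cases hq : q = ∞
  · have he0 : e = 0 := by simp [he, hq]
    rw [LqrNorm, if_pos hq]
    refine iSup₂_le fun r hr => ?_
    have := main r hr
    rw [he0, add_zero] at this
    refine this.trans ?_
    refine mul_le_mul' le_rfl (Finset.sum_le_sum fun m _ => Finset.sum_le_sum fun ops _ =>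
      ENNReal.rpow_le_rpow ?_ (by positivity))
    unfold Win
    refine lintegral_mono_set fun s hs => ?_
    simp only [mem_Ioi]; linarith [hs.1]
  · have hpq' : p ≤ q.toReal := by
      have := ENNReal.toReal_mono hq hpq
      rwa [ENNReal.toReal_ofReal hp0.le] at this
    set Q := q.toReal with hQ
    have hQ0 : 0 < Q := by linarith
    rw [LqrNorm, if_neg hq, ← hQ]
    have hWm : ∀ m ops, Measurable (fun r => Win (fun s => G m ops s ^ p) r ^ (1/p)) := fun m ops =>
      (Win_measurable ((hGm m ops).pow_const p)).pow_const _
    calc _ ≤ (∫⁻ r in Ioi (R+1), (K * ∑ m ∈ Finset.range ((n+2)/2 + 1), ∑ ops : Fin m → YIdx n, Win (fun s => G m ops s ^ p) r ^ (1/p)) ^ Q) ^ (1/Q) := by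
          refine ENNReal.rpow_le_rpow ?_ (by positivity)
          refine setLIntegral_mono' measurableSet_Ioi fun r hr => ?_
          have hr0 : 0 < r := by simp only [mem_Ioi] at hr; linarith
          refine le_trans (le_of_eq ?_) (ENNReal.rpow_le_rpow (main r hr) hQ0.le)
          rw [ENNReal.mul_rpow_of_nonneg _ _ hQ0.le, ENNReal.mul_rpow_of_nonneg _ _ hQ0.le, mul_right_comm]
          congr 1
          rw [ENNReal.ofReal_rpow_of_nonneg (by positivity) hQ0.le, ENNReal.ofReal_rpow_of_nonneg (by positivity) hQ0.le,
            ← ENNReal.ofReal_mul (by positivity), ← Real.rpow_mul hr0.le, ← Real.rpow_mul hr0.le, ← Real.rpow_add hr0]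
          congr 2
          rw [he]
          field_simp
      _ = K * (∫⁻ r in Ioi (R+1), (∑ m ∈ Finset.range ((n+2)/2 + 1), ∑ ops : Fin m → YIdx n, Win (fun s => G m ops s ^ p) r ^ (1/p)) ^ Q) ^ (1/Q) := by
          simp only [ENNReal.mul_rpow_of_nonneg _ _ hQ0.le]
          rw [lintegral_const_mul' _ _ (ENNReal.rpow_lt_top_of_nonneg hQ0.le hK).ne, ENNReal.mul_rpow_of_nonneg _ _ (by positivity),
            ← ENNReal.rpow_mul, mul_one_div_cancel hQ0.ne', ENNReal.rpow_one]
      _ ≤ _ := by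
          refine mul_le_mul' le_rfl ?_
          refine (minkowski_sum _ Q (by linarith) _ _ fun m => Finset.measurable_fun_sum _ fun ops _ => hWm m ops).trans ?_
          refine Finset.sum_le_sum fun m _ => ?_
          refine (minkowski_sum _ Q (by linarith) _ _ fun ops => hWm m ops).trans ?_
          exact Finset.sum_le_sum fun ops _ => window_core (hGm m ops) (by linarith) hpq'
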